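/- Let {ρ_i}_{i∈ℤ^d} be measurable functions ρ_i : Ω → [0,∞) with λ_i(ρ_i ∣ ω) = 1 for all i and ω, satisfying hypotheses (H1) and (H2), and let {ρ_Λ}_{Λ∈𝒮} be the family defined by the recursion ρ_{Λ∪{i}} = ρ_Λ/R_Λ^i with R_Λ^i(ω) = ((ρ_Λ/ρ_i) · λ_i(ρ_i ρ_Λ^{-1}))(x_Λ ω) for x_Λ ∈ b(Λ,{i},ω). Then for every finite Λ ⊆ ℤ^d, every Γ ⊆ Λ and every bounded measurable function h: (ρ_Λ λ_Λ)((ρ_Γ λ_Γ)(h)) = (ρ_Λ λ_Λ)(h); that is, the kernels ρ_Λ λ_Λ are consistent. -/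

import Mathlib

open MeasureTheory ProbabilityTheory
open scoped ENNReal NNReal

namespace GibbsSingleton

/-- Configuration space `E^ι`. -/
abbrev Config (ι E : Type*) := ι → E

variable {ι E : Type*}

/-- The configuration equal to `σ` on `Λ` and to `ω` off `Λ`. -/
def subst [DecidableEq ι] (Λ : Finset ι) (σ : {x // x ∈ Λ} → E) (ω : Config ι E) :
    Config ι E := fun i => if h : i ∈ Λ then σ ⟨i, h⟩ else ω i

variable [MeasurableSpace E]

/-- The free kernel `λ_Λ` applied to an `ℝ≥0∞`-valued function:
`λ_Λ(h ∣ ω) = ∫ h(σ_Λ ω) λ^Λ(dσ_Λ)`. -/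
noncomputable def freeF [DecidableEq ι] (lam : ι → Measure E) (Λ : Finset ι)
    (h : Config ι E → ℝ≥0∞) (ω : Config ι E) : ℝ≥0∞ :=
  ∫⁻ σ : {x // x ∈ Λ} → E, h (subst Λ σ ω) ∂(Measure.pi fun i : {x // x ∈ Λ} => lam i.1)

/-- The function `ρ_i ρ_j⁻¹`, `ℝ≥0∞`-valued. -/
noncomputable def rat (ρ : ι → Config ι E → ℝ≥0) (i j : ι) (η : Config ι E) : ℝ≥0∞ :=
  (ρ i η : ℝ≥0∞) / (ρ j η : ℝ≥0∞)

/-- The set `b(j,V,ω)` of good configurations at site `j` given `ω` outside `V ∪ {j}`. -/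
noncomputable def bSet [DecidableEq ι] (lam : ι → Measure E) (ρ : ι → Config ι E → ℝ≥0)
    (j : ι) (V : Finset ι) (ω : Config ι E) : Set E :=
  {x | (∀ σ : {y // y ∈ V} → E, 0 < ρ j (subst V σ (Function.update ω j x))) ∧
    ∀ i, i ≠ j →
      0 < (⨅ σ : {y // y ∈ V} → E,
          freeF lam {i} (rat ρ i j) (subst V σ (Function.update ω j x))) ∧
      (⨆ σ : {y // y ∈ V} → E,
          freeF lam {i} (rat ρ i j) (subst V σ (Function.update ω j x))) < ⊤}

/-- The multi-site good set `b(V,W,ω)`. -/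
noncomputable def bSetF [DecidableEq ι] (lam : ι → Measure E) (ρ : ι → Config ι E → ℝ≥0)
    (V W : Finset ι) (ω : Config ι E) : Set ({x // x ∈ V} → E) :=
  {xV | ∀ k : {x // x ∈ V}, xV k ∈ bSet lam ρ k.1 ((V.erase k.1) ∪ W) ω}

/-- The set `B(j,V) = {ω : ω_j ∈ b(j,V,ω)}`. -/
noncomputable def BSet [DecidableEq ι] (lam : ι → Measure E) (ρ : ι → Config ι E → ℝ≥0)
    (j : ι) (V : Finset ι) : Set (Config ι E) :=
  {ω | ω j ∈ bSet lam ρ j V ω}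

/-- Hypothesis (H1): every good set `b(j,V,ω)` is nonempty. -/
def H1 [DecidableEq ι] (lam : ι → Measure E) (ρ : ι → Config ι E → ℝ≥0) : Prop :=
  ∀ (ω : Config ι E) (j : ι) (V : Finset ι), j ∉ V → (bSet lam ρ j V ω).Nonempty

/-- The order-consistency identity appearing in hypothesis (H2), with the convention
`1/∞ = 0` built into `ℝ≥0∞` division. -/
def H2id [DecidableEq ι] (lam : ι → Measure E) (ρ : ι → Config ι E → ℝ≥0)
    (i j : ι) (ω : Config ι E) : Prop :=
  ∀ xi ∈ bSet lam ρ i {j} ω, ∀ xj ∈ bSet lam ρ j {i} ω,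
    ((ρ i ω : ℝ≥0∞) * (ρ j (Function.update ω i xi) : ℝ≥0∞)) /
      ((ρ i (Function.update ω i xi) : ℝ≥0∞) *
        freeF lam {j} (rat ρ j i) (Function.update ω i xi))
    = ((ρ j ω : ℝ≥0∞) * (ρ i (Function.update ω j xj) : ℝ≥0∞)) /
      ((ρ j (Function.update ω j xj) : ℝ≥0∞) *
        freeF lam {i} (rat ρ i j) (Function.update ω j xj))

/-- Hypothesis (H2). -/
def H2 [DecidableEq ι] (lam : ι → Measure E) (ρ : ι → Config ι E → ℝ≥0) : Prop :=
  ∀ i j, i ≠ j → ∀ ω : Config ι E, H2id lam ρ i j ω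

/-- `R_Θ^Γ` evaluated using the choice `x_Θ`:
`((ρ_Θ/ρ_Γ) ⬝ λ_Γ(ρ_Γ ρ_Θ⁻¹))(x_Θ ω)`. -/
noncomputable def Rexpr [DecidableEq ι] (lam : ι → Measure E)
    (ρF : Finset ι → Config ι E → ℝ≥0) (Θ Γ : Finset ι) (x : {y // y ∈ Θ} → E)
    (ω : Config ι E) : ℝ≥0∞ :=
  ((ρF Θ (subst Θ x ω) : ℝ≥0∞) / (ρF Γ (subst Θ x ω) : ℝ≥0∞)) *
    freeF lam Γ (fun η => (ρF Γ η : ℝ≥0∞) / (ρF Θ η : ℝ≥0∞)) (subst Θ x ω)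

/-- The family `ρ_Λ` is obtained from the singletons `ρ_i` by the recursive construction
`ρ_{Λ∪{i}} = ρ_Λ / R_Λ^i`, `R_Λ^i(ω) = ((ρ_Λ/ρ_i) ⬝ λ_i(ρ_i ρ_Λ⁻¹))(x_Λ ω)`,
`x_Λ ∈ b(Λ,{i},ω)` (the value being independent of this choice). -/
def IsRec [DecidableEq ι] (lam : ι → Measure E) (ρ : ι → Config ι E → ℝ≥0)
    (ρF : Finset ι → Config ι E → ℝ≥0) : Prop :=
  (∀ ω, ρF ∅ ω = 1) ∧ (∀ i, ρF {i} = ρ i) ∧ (∀ Λ, Measurable (ρF Λ)) ∧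
  ∀ (Λ : Finset ι) (i : ι), i ∉ Λ → ∀ ω : Config ι E,
    (∀ x ∈ bSetF lam ρ Λ {i} ω, ∀ x' ∈ bSetF lam ρ Λ {i} ω,
      Rexpr lam ρF Λ {i} x ω = Rexpr lam ρF Λ {i} x' ω) ∧
    ∀ x ∈ bSetF lam ρ Λ {i} ω,
      (ρF (insert i Λ) ω : ℝ≥0∞) = (ρF Λ ω : ℝ≥0∞) / Rexpr lam ρF Λ {i} x ω

/-- The sub-σ-algebra `𝓕_U` of events generated by the coordinates in `U`. -/
def cylSigma (E : Type*) [MeasurableSpace E] {ι : Type*} (U : Set ι) :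
    MeasurableSpace (Config ι E) :=
  MeasurableSpace.comap (fun ω (i : U) => ω i.1) MeasurableSpace.pi

/-- A specification: a family of probability kernels, measurable w.r.t. the outside
σ-algebra, proper, and consistent. -/
def IsSpecification (γ : Finset ι → Kernel (Config ι E) (Config ι E)) : Prop :=
  (∀ Λ, IsMarkovKernel (γ Λ)) ∧
  (∀ (Λ : Finset ι) (A : Set (Config ι E)), MeasurableSet A →
    Measurable[cylSigma E ((Λ : Set ι)ᶜ)] fun ω => γ Λ ω A) ∧
  (∀ (Λ : Finset ι) (B : Set (Config ι E)), MeasurableSet[cylSigma E ((Λ : Set ι)ᶜ)] B →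
    ∀ ω, γ Λ ω B = B.indicator (fun _ => (1 : ℝ≥0∞)) ω) ∧
  (∀ Λ Δ : Finset ι, Λ ⊆ Δ → (γ Λ).comp (γ Δ) = γ Δ)

/-- The kernel family `γ` is `{ρ_Λ λ_Λ}`. -/
def MatchesDensity [DecidableEq ι] (lam : ι → Measure E)
    (γ : Finset ι → Kernel (Config ι E) (Config ι E))
    (ρF : Finset ι → Config ι E → ℝ≥0) : Prop :=
  ∀ (Λ : Finset ι) (ω : Config ι E) (A : Set (Config ι E)), MeasurableSet A →
    γ Λ ω A = freeF lam Λ (fun η => (ρF Λ η : ℝ≥0∞) * A.indicator (fun _ => 1) η) ω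

end GibbsSingleton

namespace GibbsSingleton

set_option linter.unusedSectionVars false

section helpers

open Classical in
theorem pi_restrict_box {κ : Type*} [Fintype κ] {α : κ → Type*} [∀ i, MeasurableSpace (α i)]
    (μ : ∀ i, Measure (α i)) (S : ∀ i, Set (α i)) (hS : ∀ i, MeasurableSet (S i)) :
    (Measure.pi μ).restrict (Set.univ.pi S) = Measure.pi fun i => (μ i).restrict (S i) := by
  have hbox : MeasurableSet (Set.univ.pi S) := MeasurableSet.univ_pi hS
  have ple : ∀ (ν : ∀ i, Measure (α i)) (s : ∀ i, Set (α i)),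
      Measure.pi ν (Set.univ.pi s) ≤ ∏ i, ν i (s i) := by
    intro ν s
    calc Measure.pi ν (Set.univ.pi s)
        ≤ Measure.pi ν (Set.univ.pi fun i => toMeasurable (ν i) (s i)) :=
          measure_mono (Set.pi_mono fun i _ => subset_toMeasurable _ _)
      _ ≤ ∏ i, ν i (toMeasurable (ν i) (s i)) := by
          rw [Measure.pi, toMeasure_apply _ _
            (MeasurableSet.univ_pi fun i => measurableSet_toMeasurable _ _)]
          exact OuterMeasure.pi_pi_le _ _
      _ = ∏ i, ν i (s i) := by simp
  have key : ∀ (ν : ∀ i, Measure (α i)) (n : Measure (∀ i, α i)),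
      (∀ s : ∀ i, Set (α i), n (Set.univ.pi s) ≤ ∏ i, ν i (s i)) → n ≤ Measure.pi ν := by
    intro ν n hn
    rw [Measure.le_iff]
    intro A hA
    rw [Measure.pi, toMeasure_apply _ _ hA]
    exact (OuterMeasure.le_pi (m := fun i => (ν i).toOuterMeasure) (n := n.toOuterMeasure)).2
      (fun s _ => hn s) A
  apply le_antisymm
  · apply key
    intro s
    rw [Measure.restrict_apply' hbox, ← Set.pi_inter_distrib]
    refine (ple _ _).trans (le_of_eq ?_)
    simp [Measure.restrict_apply' (hS _)]
  · have hle : (Measure.pi fun i => (μ i).restrict (S i)) ≤ Measure.pi μ := by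
      apply key
      intro s
      exact (ple _ _).trans (Finset.prod_le_prod' fun i _ => Measure.restrict_apply_le _ _)
    have h0 : (Measure.pi fun i => (μ i).restrict (S i)) (Set.univ.pi S)ᶜ = 0 := by
      have : (Set.univ.pi S)ᶜ ⊆ ⋃ i, Set.univ.pi (Function.update (fun _ => Set.univ) i (S i)ᶜ) := by
        intro x hx
        simp only [Set.mem_compl_iff, Set.mem_univ_pi, not_forall] at hx
        obtain ⟨i, hi⟩ := hx
        refine Set.mem_iUnion.2 ⟨i, ?_⟩
        intro j _
        by_cases hj : j = i
        · subst hj; simpa using hi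
        · simp [Function.update_of_ne hj]
      refine measure_mono_null this (measure_iUnion_null fun i => ?_)
      refine le_antisymm ((ple _ _).trans (le_of_eq ?_)) zero_le
      refine Finset.prod_eq_zero (Finset.mem_univ i) ?_
      simp [Measure.restrict_apply' (hS _)]
    rw [Measure.le_iff]
    intro A hA
    rw [Measure.restrict_apply' hbox]
    calc _ ≤ (Measure.pi fun i => (μ i).restrict (S i)) ((A ∩ Set.univ.pi S) ∪ (Set.univ.pi S)ᶜ) := by
          apply measure_mono
          intro x hx
          by_cases h : x ∈ Set.univ.pi S
          · exact Or.inl ⟨hx, h⟩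
          · exact Or.inr h
      _ ≤ _ := measure_union_le _ _
      _ = (Measure.pi fun i => (μ i).restrict (S i)) (A ∩ Set.univ.pi S) := by rw [h0, add_zero]
      _ ≤ _ := hle _

theorem sigmaFinite_supp {α : Type*} [MeasurableSpace α] (μ : Measure α) (f : α → ℝ≥0)
    (hf : Measurable f) (h : ∫⁻ x, f x ∂μ ≠ ⊤) : SigmaFinite (μ.restrict {x | f x ≠ 0}) := by
  have hm : MeasurableSet {x | f x ≠ 0} := (hf (measurableSet_singleton 0)).compl
  set ν := μ.restrict {x | f x ≠ 0} with hν
  have hf' : Measurable fun x => (f x : ℝ≥0∞) := hf.coe_nnreal_ennreal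
  have hne : ∀ᵐ x ∂ν, (f x : ℝ≥0∞) ≠ 0 := by
    filter_upwards [ae_restrict_mem hm] with x hx
    simpa using hx
  have h3 := withDensity_inv_same (μ := ν) hf' hne (by simp)
  have : IsFiniteMeasure (ν.withDensity fun x => (f x : ℝ≥0∞)) := by
    apply isFiniteMeasure_withDensity
    exact ne_top_of_le_ne_top h (lintegral_mono' Measure.restrict_le_self le_rfl)
  rw [← h3]
  apply SigmaFinite.withDensity_of_ne_top
  apply (withDensity_absolutelyContinuous ν _).ae_le
  filter_upwards [hne] with x hx
  simpa using hx

end helpers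

variable {ι E : Type*} [DecidableEq ι]

/-- agreement off a finite set -/
def Ag (V : Finset ι) (η ω : Config ι E) : Prop := ∀ m, m ∉ V → η m = ω m

theorem ag_subst (V : Finset ι) (σ : {x // x ∈ V} → E) (ω : Config ι E) :
    Ag V (subst V σ ω) ω := by
  intro m hm; simp [subst, hm]

theorem Ag.eq_subst {V : Finset ι} {η ω : Config ι E} (h : Ag V η ω) :
    subst V (fun m => η m.1) ω = η := by
  funext m
  by_cases hm : m ∈ V
  · simp [subst, hm]
  · simp [subst, hm, h m hm]

theorem Ag.mono {V W : Finset ι} {η ω : Config ι E} (h : Ag V η ω) (hVW : V ⊆ W) : Ag W η ω :=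
  fun m hm => h m fun h' => hm (hVW h')

theorem Ag.symm {V : Finset ι} {η ω : Config ι E} (h : Ag V η ω) : Ag V ω η :=
  fun m hm => (h m hm).symm

theorem Ag.trans {V : Finset ι} {η ω ζ : Config ι E} (h : Ag V η ω) (h' : Ag V ω ζ) : Ag V η ζ :=
  fun m hm => (h m hm).trans (h' m hm)

theorem Ag.refl {V : Finset ι} (η : Config ι E) : Ag V η η := fun _ _ => rfl

theorem Ag.subst_eq {V : Finset ι} {η ω : Config ι E} (h : Ag V η ω) (σ : {x // x ∈ V} → E) :
    subst V σ η = subst V σ ω := by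
  funext m
  by_cases hm : m ∈ V
  · simp [subst, hm]
  · simp [subst, hm, h m hm]

variable [MeasurableSpace E]

theorem measurable_subst (V : Finset ι) (ω : Config ι E) :
    Measurable fun σ : {x // x ∈ V} → E => subst V σ ω := by
  refine measurable_pi_lambda _ fun m => ?_
  by_cases hm : m ∈ V
  · simp only [subst, hm, dif_pos]; exact measurable_pi_apply _
  · simp only [subst, hm, dif_neg, not_false_eq_true]; exact measurable_const

theorem measurable_subst' (V : Finset ι) (σ : {x // x ∈ V} → E) :
    Measurable fun ω : Config ι E => subst V σ ω := by
  refine measurable_pi_lambda _ fun m => ?_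
  by_cases hm : m ∈ V
  · simp only [subst, hm, dif_pos]; exact measurable_const
  · simp only [subst, hm, dif_neg, not_false_eq_true]; exact measurable_pi_apply _

theorem freeF_congr (lam : ι → Measure E) {V : Finset ι} {f g : Config ι E → ℝ≥0∞}
    {ω : Config ι E} (h : ∀ η, Ag V η ω → f η = g η) : freeF lam V f ω = freeF lam V g ω := by
  unfold freeF
  exact lintegral_congr fun σ => h _ (ag_subst _ _ _)

theorem freeF_ag (lam : ι → Measure E) {V : Finset ι} (f : Config ι E → ℝ≥0∞)
    {η ω : Config ι E} (h : Ag V η ω) : freeF lam V f η = freeF lam V f ω := by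
  unfold freeF
  exact lintegral_congr fun σ => by rw [h.subst_eq]

theorem freeF_eq_lmarginal (lam : ι → Measure E) (V : Finset ι) (f : Config ι E → ℝ≥0∞) :
    freeF lam V f = lmarginal lam V f := rfl

theorem freeF_union (lam : ι → Measure E) [∀ i, SigmaFinite (lam i)] {V W : Finset ι}
    (hd : Disjoint V W) {f : Config ι E → ℝ≥0∞} (hf : Measurable f) (ω : Config ι E) :
    freeF lam (V ∪ W) f ω = freeF lam V (freeF lam W f) ω := by
  simp only [freeF_eq_lmarginal]
  rw [lmarginal_union lam f hf hd]

theorem freeF_measurable (lam : ι → Measure E) [∀ i, SigmaFinite (lam i)] (V : Finset ι)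
    {f : Config ι E → ℝ≥0∞} (hf : Measurable f) : Measurable (freeF lam V f) :=
  hf.lmarginal lam

theorem freeF_const_mul (lam : ι → Measure E) {V : Finset ι} (a : ℝ≥0∞) {f : Config ι E → ℝ≥0∞}
    (hf : Measurable f) (ω : Config ι E) :
    freeF lam V (fun η => a * f η) ω = a * freeF lam V f ω := by
  unfold freeF
  exact lintegral_const_mul a (hf.comp (measurable_subst V ω))

/-- change of measures to the restriction to a box -/
theorem freeF_restrict (lam : ι → Measure E) {V : Finset ι} (S : ι → Set E)
    (hS : ∀ i, MeasurableSet (S i)) {f : Config ι E → ℝ≥0∞} {ω : Config ι E}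
    (h : ∀ η, Ag V η ω → f η ≠ 0 → ∀ i ∈ V, η i ∈ S i) :
    freeF (fun i => (lam i).restrict (S i)) V f ω = freeF lam V f ω := by
  unfold freeF
  rw [← pi_restrict_box (fun i : {x // x ∈ V} => lam i.1) (fun i => S i.1) (fun i => hS i.1)]
  have hb : MeasurableSet (Set.univ.pi fun i : {x // x ∈ V} => S i.1) :=
    MeasurableSet.univ_pi fun i => hS i.1
  rw [← lintegral_indicator hb]
  refine lintegral_congr fun σ => ?_
  by_cases hσ : σ ∈ Set.univ.pi fun i : {x // x ∈ V} => S i.1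
  · rw [Set.indicator_of_mem hσ]
  · rw [Set.indicator_of_notMem hσ]
    by_contra h0
    apply hσ
    intro i _
    have := h _ (ag_subst V σ ω) (Ne.symm h0) i.1 i.2
    simpa [subst] using this

theorem freeF_singleton (lam : ι → Measure E) (i : ι) (f : Config ι E → ℝ≥0∞) (ω : Config ι E) :
    freeF lam {i} f ω = ∫⁻ z, f (Function.update ω i z) ∂lam i := by
  rw [freeF_eq_lmarginal, lmarginal_singleton]

variable {lam : ι → Measure E} {ρ : ι → Config ι E → ℝ≥0} {ρF : Finset ι → Config ι E → ℝ≥0}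

theorem mem_bSet_iff {j : ι} {V : Finset ι} {ω : Config ι E} {x : E} :
    x ∈ bSet lam ρ j V ω ↔ (∀ η, Ag V η (Function.update ω j x) → 0 < ρ j η) ∧
      ∀ i, i ≠ j → ∃ c C : ℝ≥0∞, 0 < c ∧ C < ⊤ ∧ ∀ η, Ag V η (Function.update ω j x) →
        c ≤ freeF lam {i} (rat ρ i j) η ∧ freeF lam {i} (rat ρ i j) η ≤ C := by
  constructor
  · rintro ⟨hp, hb⟩
    refine ⟨fun η hη => by simpa [hη.eq_subst] using hp fun m => η m.1, fun i hi => ?_⟩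
    refine ⟨_, _, (hb i hi).1, (hb i hi).2, fun η hη => ⟨?_, ?_⟩⟩
    · refine (iInf_le _ fun m => η m.1).trans ?_
      rw [hη.eq_subst]
    · refine le_trans ?_ (le_iSup _ fun m => η m.1)
      rw [hη.eq_subst]
  · rintro ⟨hp, hb⟩
    refine ⟨fun σ => hp _ (ag_subst _ _ _), fun i hi => ?_⟩
    obtain ⟨c, C, hc, hC, h⟩ := hb i hi
    exact ⟨hc.trans_le (le_iInf fun σ => (h _ (ag_subst _ _ _)).1),
      (iSup_le fun σ => (h _ (ag_subst _ _ _)).2).trans_lt hC⟩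

theorem bSet_mono {j : ι} {V V' : Finset ι} {ω ω' : Config ι E} {x : E} (hV : V' ⊆ V)
    (hj : j ∉ V) (hω : Ag (insert j V) ω' ω) (hx : x ∈ bSet lam ρ j V ω) :
    x ∈ bSet lam ρ j V' ω' := by
  have key : ∀ η, Ag V' η (Function.update ω' j x) → Ag V η (Function.update ω j x) := by
    intro η hη m hm
    rw [hη m fun h => hm (hV h)]
    by_cases hmj : m = j
    · subst hmj; simp
    · rw [Function.update_of_ne hmj, Function.update_of_ne hmj]
      exact hω m (by simp [hmj, hm])
  rw [mem_bSet_iff] at hx ⊢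
  refine ⟨fun η hη => hx.1 η (key η hη), fun i hi => ?_⟩
  obtain ⟨c, C, hc, hC, h⟩ := hx.2 i hi
  exact ⟨c, C, hc, hC, fun η hη => h η (key η hη)⟩

theorem inv_alg {a b M : ℝ≥0∞} (ha : a ≠ 0) (ha' : a ≠ ⊤) (hb' : b ≠ ⊤) (hM : M ≠ 0)
    (hM' : M ≠ ⊤) : (a / b * M)⁻¹ = b / a * M⁻¹ := by
  by_cases hb : b = 0
  · subst hb
    simp [ENNReal.div_zero ha, ENNReal.top_mul hM]
  · rw [ENNReal.mul_inv (Or.inr hM') (Or.inr hM), ENNReal.inv_div (Or.inl hb') (Or.inl hb)]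

theorem rec_good (hrec : IsRec lam ρ ρF) {Δ : Finset ι} {k : ι} (hk : k ∉ Δ) {η : Config ι E}
    (hg : ∀ j ∈ Δ, η j ∈ bSet lam ρ j (Δ.erase j ∪ {k}) η) (hpos : 0 < ρF Δ η)
    (hM : freeF lam {k} (fun η => (ρ k η : ℝ≥0∞) / (ρF Δ η : ℝ≥0∞)) η ≠ 0)
    (hM' : freeF lam {k} (fun η => (ρ k η : ℝ≥0∞) / (ρF Δ η : ℝ≥0∞)) η ≠ ⊤) :
    (ρF (insert k Δ) η : ℝ≥0∞) =
      ρ k η * (freeF lam {k} (fun η => (ρ k η : ℝ≥0∞) / (ρF Δ η : ℝ≥0∞)) η)⁻¹ := by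
  have h := (hrec.2.2.2 Δ k hk η).2 (fun m => η m.1) (fun j => hg j.1 j.2)
  rw [h, Rexpr, (Ag.refl η).eq_subst, hrec.2.1 k, div_eq_mul_inv, inv_alg (by simpa using hpos.ne')
    (by simp) (by simp) hM hM', ← mul_assoc, ENNReal.mul_div_cancel (by simpa using hpos.ne')
    (by simp)]

theorem good_claim (hnorm : ∀ (i : ι) (ω : Config ι E),
      freeF lam {i} (fun η => (ρ i η : ℝ≥0∞)) ω = 1)
    (hrec : IsRec lam ρ ρF) (Δ : Finset ι) : ∀ (V : Finset ι) (ω : Config ι E), Disjoint Δ V →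
      (∀ j ∈ Δ, ω j ∈ bSet lam ρ j (Δ.erase j ∪ V) ω) →
      (∀ i ∈ V, (∀ η, Ag V η ω → 0 < ρF Δ η) ∧
        ∃ c C : ℝ≥0∞, 0 < c ∧ C < ⊤ ∧ ∀ η, Ag V η ω →
        c ≤ freeF lam {i} (fun η => (ρ i η : ℝ≥0∞) / (ρF Δ η : ℝ≥0∞)) η ∧
        freeF lam {i} (fun η => (ρ i η : ℝ≥0∞) / (ρF Δ η : ℝ≥0∞)) η ≤ C) := by
  induction Δ using Finset.induction_on with
  | empty =>
    intro V ω _ _ i hi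
    refine ⟨fun η _ => by simp [hrec.1], 1, 1, by simp, by simp, fun η _ => ?_⟩
    simp [hrec.1, hnorm]
  | insert k Δ hk ih =>
    intro V ω hd hg i hi
    rw [Finset.disjoint_insert_left] at hd
    have hik : i ≠ k := fun h => hd.1 (h ▸ hi)
    have hV' : ∀ j ∈ Δ, ω j ∈ bSet lam ρ j (Δ.erase j ∪ insert k V) ω := by
      intro j hj
      have hjk : j ≠ k := fun h => hk (h ▸ hj)
      have := hg j (Finset.mem_insert_of_mem hj)
      convert this using 2
      ext m
      simp only [Finset.mem_union, Finset.mem_erase, Finset.mem_insert]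
      by_cases hm : m = k
      · subst hm; simp [hjk.symm]
      · simp [hm]
    have hd' : Disjoint Δ (insert k V) := by
      rw [Finset.disjoint_insert_right]; exact ⟨hk, hd.2⟩
    obtain ⟨hpos, c, C, hc, hC, hb⟩ := ih (insert k V) ω hd' hV' k (Finset.mem_insert_self _ _)
    have hkω := mem_bSet_iff.1 (hg k (Finset.mem_insert_self _ _))
    rw [Finset.erase_insert hk, Function.update_eq_self] at hkω
    -- formula
    have formula : ∀ η, Ag V η ω → (ρF (insert k Δ) η : ℝ≥0∞) =
        ρ k η * (freeF lam {k} (fun η => (ρ k η : ℝ≥0∞) / (ρF Δ η : ℝ≥0∞)) η)⁻¹ := by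
      intro η hη
      have hη' := hη.mono (Finset.subset_insert k V)
      refine rec_good hrec hk ?_ (hpos η hη') (hc.trans_le (hb η hη').1).ne'
        ((hb η hη').2.trans_lt hC).ne
      intro j hj
      have hjV : j ∉ V := fun h => Finset.disjoint_left.1 hd.2 hj h
      have hjk : j ≠ k := fun h => hk (h ▸ hj)
      rw [hη j hjV]
      refine bSet_mono ?_ ?_ ?_ (hV' j hj)
      · intro m hm
        simp only [Finset.mem_union, Finset.mem_erase, Finset.mem_insert,
          Finset.mem_singleton] at hm ⊢
        tauto
      · simp [hjV, hjk]
      · refine hη.mono ?_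
        intro m hm
        simp [hm]
    have hAgk : ∀ η, Ag V η ω → Ag (Δ ∪ V) η ω := fun η hη => hη.mono Finset.subset_union_right
    refine ⟨fun η hη => ?_, ?_⟩
    · have hη' := hη.mono (Finset.subset_insert k V)
      have h0 : (ρF (insert k Δ) η : ℝ≥0∞) ≠ 0 := by
        rw [formula η hη]
        refine mul_ne_zero ?_ ?_
        · simpa using (hkω.1 η (hAgk η hη)).ne'
        · simpa using ((hb η hη').2.trans_lt hC).ne
      exact pos_iff_ne_zero.2 (by simpa using h0)
    · obtain ⟨c', C', hc', hC', hb'⟩ := hkω.2 i hik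
      have hratio : ∀ η, Ag V η ω → (ρ i η : ℝ≥0∞) / (ρF (insert k Δ) η : ℝ≥0∞) =
          rat ρ i k η * freeF lam {k} (fun η => (ρ k η : ℝ≥0∞) / (ρF Δ η : ℝ≥0∞)) η := by
        intro η hη
        have hη' := hη.mono (Finset.subset_insert k V)
        rw [formula η hη, rat, div_eq_mul_inv, div_eq_mul_inv, mul_assoc,
          ENNReal.mul_inv (Or.inr (by simpa using (hc.trans_le (hb η hη').1).ne'))
            (Or.inl (by simp)), inv_inv]
      have hCne : c ≠ ⊤ := by
        have := hb ω (Ag.refl ω)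
        exact ((this.1.trans this.2).trans_lt hC).ne
      have hiV : ∀ η, Ag V η ω → ∀ ζ, Ag {i} ζ η → Ag V ζ ω := fun η hη ζ hζ =>
        (hζ.mono (by simpa using hi)).trans hη
      refine ⟨c' * c, C' * C, ENNReal.mul_pos hc'.ne' hc.ne', ENNReal.mul_lt_top hC' hC,
        fun η hη => ?_⟩
      rw [freeF_congr lam (fun ζ hζ => hratio ζ (hiV η hη ζ hζ))]
      have hm := hb' η (hAgk η hη)
      constructor
      · calc c' * c ≤ freeF lam {i} (rat ρ i k) η * c := by gcongr; exact hm.1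
          _ = freeF lam {i} (fun ζ => rat ρ i k ζ * c) η := by
            unfold freeF; rw [lintegral_mul_const' _ _ hCne]
          _ ≤ _ := by
            unfold freeF
            refine lintegral_mono fun σ => ?_
            have hA := (hiV η hη _ (ag_subst {i} σ η)).mono (Finset.subset_insert k V)
            exact mul_le_mul_right (hb _ hA).1 _
      · calc _ ≤ freeF lam {i} (fun ζ => rat ρ i k ζ * C) η := by
              unfold freeF
              refine lintegral_mono fun σ => ?_
              have hA := (hiV η hη _ (ag_subst {i} σ η)).mono (Finset.subset_insert k V)
              exact mul_le_mul_right (hb _ hA).2 _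
          _ = freeF lam {i} (rat ρ i k) η * C := by
            unfold freeF; rw [lintegral_mul_const' _ _ hC.ne]
          _ ≤ C' * C := by gcongr; exact hm.2

theorem step (hnorm : ∀ (i : ι) (ω : Config ι E),
      freeF lam {i} (fun η => (ρ i η : ℝ≥0∞)) ω = 1)
    (h1 : H1 lam ρ) (hrec : IsRec lam ρ ρF) (Λ : Finset ι) (i : ι) (hi : i ∉ Λ)
    (ω : Config ι E) : ∃ (x : {y // y ∈ Λ} → E) (M : ℝ≥0∞), M ≠ 0 ∧ M ≠ ⊤ ∧
      ∀ η, Ag (insert i Λ) η ω → ρF Λ (subst Λ x η) ≠ 0 ∧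
        freeF lam {i} (fun η => (ρ i η : ℝ≥0∞) / (ρF Λ η : ℝ≥0∞)) (subst Λ x η) = M ∧
        (ρF (insert i Λ) η : ℝ≥0∞) = ((ρ i (subst Λ x η) : ℝ≥0∞) / (ρF Λ (subst Λ x η) : ℝ≥0∞)
          * M⁻¹) * ρF Λ η := by
  have hkn : ∀ k : {y // y ∈ Λ}, k.1 ∉ Λ.erase k.1 ∪ {i} := by
    intro k
    have : k.1 ≠ i := fun h => hi (h ▸ k.2)
    simp [this]
  have hins : ∀ k : {y // y ∈ Λ}, insert k.1 (Λ.erase k.1 ∪ {i}) = insert i Λ := by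
    intro k
    ext m
    have := k.2
    by_cases hm : m = k.1
    · subst hm; simp
    · simp [hm]
  choose x hx using fun k : {y // y ∈ Λ} => h1 ω k.1 (Λ.erase k.1 ∪ {i}) (hkn k)
  have hgood : ∀ η, Ag (insert i Λ) η ω → ∀ k : {y // y ∈ Λ},
      x k ∈ bSet lam ρ k.1 (Λ.erase k.1 ∪ {i}) η := fun η hη k =>
    bSet_mono (Finset.Subset.refl _) (hkn k) (by rw [hins]; exact hη) (hx k)
  have hsub : ∀ η, Ag (insert i Λ) η ω → Ag {i} (subst Λ x η) (subst Λ x ω) := by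
    intro η hη m hm
    by_cases hmΛ : m ∈ Λ
    · simp [subst, hmΛ]
    · simp only [subst, hmΛ, dif_neg, not_false_eq_true]
      exact hη m (by simp at hm; simp [hm, hmΛ])
  have hd : Disjoint Λ {i} := by simpa using hi
  obtain ⟨hpos, c, C, hc, hC, hb⟩ := good_claim hnorm hrec Λ {i} (subst Λ x ω) hd
    (fun j hj => by
      have h := hgood (subst Λ x ω) ((ag_subst Λ x ω).mono (Finset.subset_insert _ _)) ⟨j, hj⟩
      have e : subst Λ x ω j = x ⟨j, hj⟩ := by simp [subst, hj]
      rw [e]; exact h) i (by simp)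
  have hb0 := hb _ (Ag.refl _)
  refine ⟨x, freeF lam {i} (fun η => (ρ i η : ℝ≥0∞) / (ρF Λ η : ℝ≥0∞)) (subst Λ x ω),
    (hc.trans_le hb0.1).ne', (hb0.2.trans_lt hC).ne, fun η hη => ?_⟩
  have hM := freeF_ag lam (fun η => (ρ i η : ℝ≥0∞) / (ρF Λ η : ℝ≥0∞)) (hsub η hη)
  have hp := (hpos _ (hsub η hη)).ne'
  refine ⟨hp, hM, ?_⟩
  rw [(hrec.2.2.2 Λ i hi η).2 x (hgood η hη), Rexpr, hrec.2.1 i, hM, div_eq_mul_inv,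
    inv_alg (by simpa using hp) (by simp) (by simp) (hc.trans_le hb0.1).ne'
      (hb0.2.trans_lt hC).ne, mul_comm]

theorem factor (hnorm : ∀ (i : ι) (ω : Config ι E),
      freeF lam {i} (fun η => (ρ i η : ℝ≥0∞)) ω = 1)
    (h1 : H1 lam ρ) (hrec : IsRec lam ρ ρF) (Γ s : Finset ι) (hs : Disjoint s Γ)
    (η : Config ι E) : ∃ a : ℝ≥0∞, ∀ ζ, Ag Γ ζ η → (ρF (s ∪ Γ) ζ : ℝ≥0∞) = a * ρF Γ ζ := by
  induction s using Finset.induction_on with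
  | empty => exact ⟨1, fun ζ _ => by simp⟩
  | insert i s hi ih =>
    rw [Finset.disjoint_insert_left] at hs
    obtain ⟨a, ha⟩ := ih hs.2
    obtain ⟨x, M, -, -, h⟩ := step hnorm h1 hrec (s ∪ Γ) i (by simp [hi, hs.1]) η
    refine ⟨((ρ i (subst (s ∪ Γ) x η) : ℝ≥0∞) / (ρF (s ∪ Γ) (subst (s ∪ Γ) x η) : ℝ≥0∞)
          * M⁻¹) * a, fun ζ hζ => ?_⟩
    have hζ' : Ag (s ∪ Γ) ζ η := hζ.mono Finset.subset_union_right
    rw [Finset.insert_union, (h ζ (hζ'.mono (Finset.subset_insert _ _))).2.2, ha ζ hζ,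
      hζ'.subst_eq, mul_assoc _ a]

theorem supp (hmeas : ∀ i, Measurable (ρ i)) (hnorm : ∀ (i : ι) (ω : Config ι E),
      freeF lam {i} (fun η => (ρ i η : ℝ≥0∞)) ω = 1)
    (h1 : H1 lam ρ) (hrec : IsRec lam ρ ρF) (Λ : Finset ι) (ω : Config ι E) :
    ∃ S : ι → Set E, (∀ i, MeasurableSet (S i)) ∧ (∀ i, SigmaFinite ((lam i).restrict (S i))) ∧
      ∀ η, Ag Λ η ω → ρF Λ η ≠ 0 → ∀ i ∈ Λ, η i ∈ S i := by
  have : ∀ i, ∃ T : Set E, MeasurableSet T ∧ SigmaFinite ((lam i).restrict T) ∧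
      (i ∈ Λ → ∀ η, Ag Λ η ω → ρF Λ η ≠ 0 → η i ∈ T) := by
    intro i
    by_cases hi : i ∈ Λ
    · obtain ⟨x, M, hM, hM', h⟩ := step hnorm h1 hrec (Λ.erase i) i (by simp) ω
      rw [Finset.insert_erase hi] at h
      have hf : Measurable fun z => ρ i (Function.update (subst (Λ.erase i) x ω) i z) :=
        (hmeas i).comp (measurable_update _)
      refine ⟨{z | ρ i (Function.update (subst (Λ.erase i) x ω) i z) ≠ 0},
        (hf (measurableSet_singleton 0)).compl, sigmaFinite_supp _ _ hf ?_, fun _ η hη h0 => ?_⟩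
      · have := hnorm i (subst (Λ.erase i) x ω)
        rw [freeF_singleton] at this
        rw [this]; simp
      · have e : Function.update (subst (Λ.erase i) x ω) i (η i) = subst (Λ.erase i) x η := by
          funext m
          by_cases hm : m = i
          · subst hm; simp [subst]
          · rw [Function.update_of_ne hm]
            by_cases hmΛ : m ∈ Λ
            · simp [subst, hm, hmΛ]
            · simp [subst, hm, hmΛ, hη m hmΛ]
        rw [Set.mem_ofPred_eq, e]
        intro h00
        have := (h η hη).2.2
        rw [h00] at this
        simp at this
        exact h0 this
    · exact ⟨∅, MeasurableSet.empty, by rw [Measure.restrict_empty]; infer_instance,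
        fun h => absurd h hi⟩
  choose S hS using this
  exact ⟨S, fun i => (hS i).1, fun i => (hS i).2.1, fun η hη h0 i hi => (hS i).2.2 hi η hη h0⟩

theorem normalized (hmeas : ∀ i, Measurable (ρ i)) (hnorm : ∀ (i : ι) (ω : Config ι E),
      freeF lam {i} (fun η => (ρ i η : ℝ≥0∞)) ω = 1)
    (h1 : H1 lam ρ) (hrec : IsRec lam ρ ρF) (Λ : Finset ι) :
    ∀ ω, freeF lam Λ (fun η => (ρF Λ η : ℝ≥0∞)) ω = 1 := by
  have hmF : ∀ Λ, Measurable fun η => (ρF Λ η : ℝ≥0∞) := fun Λ =>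
    (hrec.2.2.1 Λ).coe_nnreal_ennreal
  induction Λ using Finset.induction_on with
  | empty => intro ω; rw [freeF_eq_lmarginal, lmarginal_empty]; simp [hrec.1]
  | insert i Λ hi ih =>
    intro ω
    obtain ⟨S, hSm, hSf, hS⟩ := supp hmeas hnorm h1 hrec (insert i Λ) ω
    obtain ⟨x, M, hM, hM', h⟩ := step hnorm h1 hrec Λ i hi ω
    rw [← freeF_restrict lam S hSm (fun η hη h0 => hS η hη (by simpa using h0)),
      Finset.insert_eq, freeF_union _ (by simpa using hi) (hmF _), ← Finset.insert_eq]
    have hA : ∀ η, Ag {i} η ω → ∀ ζ, Ag Λ ζ η → Ag (insert i Λ) ζ ω := fun η hη ζ hζ =>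
      (hζ.mono (Finset.subset_insert _ _)).trans (hη.mono (by simp))
    have hfac : ∀ η, Ag {i} η ω → ∀ ζ, Ag Λ ζ η → (ρF (insert i Λ) ζ : ℝ≥0∞) =
        ((ρ i (subst Λ x η) : ℝ≥0∞) / (ρF Λ (subst Λ x η) : ℝ≥0∞) * M⁻¹) * ρF Λ ζ := by
      intro η hη ζ hζ
      rw [(h ζ (hA η hη ζ hζ)).2.2, hζ.subst_eq]
    have e1 : ∀ η, Ag {i} η ω → freeF (fun i => (lam i).restrict (S i)) Λ
        (fun η => (ρF (insert i Λ) η : ℝ≥0∞)) η =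
        (ρ i (subst Λ x η) : ℝ≥0∞) / (ρF Λ (subst Λ x η) : ℝ≥0∞) * M⁻¹ := by
      intro η hη
      rw [freeF_restrict lam S hSm (fun ζ hζ h0 j hj => hS ζ (hA η hη ζ hζ) (by simpa using h0) j
        (Finset.mem_insert_of_mem hj)), freeF_congr lam (hfac η hη), freeF_const_mul _ _ (hmF Λ),
        ih η, mul_one]
    rw [freeF_congr _ e1, freeF_restrict lam S hSm]
    · have hcomm : ∀ σ, subst Λ x (subst {i} σ ω) = subst {i} σ (subst Λ x ω) := by
        intro σ
        funext m
        by_cases hm : m = i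
        · subst hm; simp [subst, hi]
        · simp [subst, hm]
      have := (h ω (Ag.refl ω)).2.1
      unfold freeF at this ⊢
      rw [lintegral_mul_const' _ _ (by simpa using hM)]
      simp only [hcomm]
      rw [this, ENNReal.mul_inv_cancel hM hM']
    · intro η hη h0 j hj
      rw [Finset.mem_singleton] at hj
      subst hj
      have : ∃ ζ, Ag Λ ζ η ∧ ρF Λ ζ ≠ 0 := by
        by_contra! hcon
        have h2 := ih η
        rw [freeF_congr lam (g := fun _ => 0) (fun ζ hζ => by simp [hcon ζ hζ])] at h2
        simp [freeF] at h2
      obtain ⟨ζ, hζ, hζ0⟩ := this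
      have h3 := hS ζ (hA η hη ζ hζ) (by
        have : (ρF (insert j Λ) ζ : ℝ≥0∞) ≠ 0 := by
          rw [hfac η hη ζ hζ]
          exact mul_ne_zero h0 (by simpa using hζ0)
        simpa using this) j (Finset.mem_insert_self _ _)
      rwa [hζ j hi] at h3

theorem core (hmeas : ∀ i, Measurable (ρ i)) (hnorm : ∀ (i : ι) (ω : Config ι E),
      freeF lam {i} (fun η => (ρ i η : ℝ≥0∞)) ω = 1)
    (h1 : H1 lam ρ) (hrec : IsRec lam ρ ρF) (Λ Γ : Finset ι) (hΓ : Γ ⊆ Λ)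
    (h : Config ι E → ℝ≥0∞) (hh : Measurable h) (ω : Config ι E) :
    freeF lam Λ
      (fun η => (ρF Λ η : ℝ≥0∞) * freeF lam Γ (fun ζ => (ρF Γ ζ : ℝ≥0∞) * h ζ) η) ω
    = freeF lam Λ (fun η => (ρF Λ η : ℝ≥0∞) * h η) ω := by
  have hmF : ∀ Λ, Measurable fun η => (ρF Λ η : ℝ≥0∞) := fun Λ =>
    (hrec.2.2.1 Λ).coe_nnreal_ennreal
  obtain ⟨S, hSm, hSf, hS⟩ := supp hmeas hnorm h1 hrec Λ ω
  have hΛ : Λ \ Γ ∪ Γ = Λ := Finset.sdiff_union_of_subset hΓ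
  have hdis : Disjoint (Λ \ Γ) Γ := Finset.sdiff_disjoint
  have hfac : ∀ η, ∃ a : ℝ≥0∞, ∀ ζ, Ag Γ ζ η → (ρF Λ ζ : ℝ≥0∞) = a * ρF Γ ζ := by
    intro η
    have := factor hnorm h1 hrec Γ (Λ \ Γ) hdis η
    rwa [hΛ] at this
  have hres : ∀ η, Ag Λ η ω → ∀ a : ℝ≥0∞, a ≠ 0 →
      (∀ ζ, Ag Γ ζ η → (ρF Λ ζ : ℝ≥0∞) = a * ρF Γ ζ) → ∀ g : Config ι E → ℝ≥0∞,
      freeF (fun i => (lam i).restrict (S i)) Γ (fun ζ => (ρF Γ ζ : ℝ≥0∞) * g ζ) η =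
        freeF lam Γ (fun ζ => (ρF Γ ζ : ℝ≥0∞) * g ζ) η := by
    intro η hη a ha hfa g
    refine freeF_restrict lam S hSm fun ζ hζ h0 i hi => ?_
    refine hS ζ ((hζ.mono hΓ).trans hη) ?_ i (hΓ hi)
    have : (ρF Λ ζ : ℝ≥0∞) ≠ 0 := by
      rw [hfa ζ hζ]
      exact mul_ne_zero ha (left_ne_zero_of_mul h0)
    simpa using this
  set lam' : ι → Measure E := fun i => (lam i).restrict (S i) with hlam'
  rw [← freeF_restrict lam S hSm (f := fun η => (ρF Λ η : ℝ≥0∞) * h η)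
      (fun η hη h0 => hS η hη (by simpa using left_ne_zero_of_mul h0)),
    ← freeF_restrict lam S hSm
      (fun η hη h0 => hS η hη (by simpa using left_ne_zero_of_mul h0)), ← hlam']
  have hm2 : Measurable fun ζ => (ρF Γ ζ : ℝ≥0∞) * h ζ := (hmF Γ).mul hh
  have e1 : ∀ η, Ag Λ η ω →
      (ρF Λ η : ℝ≥0∞) * freeF lam Γ (fun ζ => (ρF Γ ζ : ℝ≥0∞) * h ζ) η =
      (ρF Λ η : ℝ≥0∞) * freeF lam' Γ (fun ζ => (ρF Γ ζ : ℝ≥0∞) * h ζ) η := by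
    intro η hη
    obtain ⟨a, ha⟩ := hfac η
    by_cases ha0 : a = 0
    · rw [ha η (Ag.refl η), ha0]; simp
    · rw [hres η hη a ha0 ha]
  rw [freeF_congr lam' e1]
  have hm3 : Measurable fun η =>
      (ρF Λ η : ℝ≥0∞) * freeF lam' Γ (fun ζ => (ρF Γ ζ : ℝ≥0∞) * h ζ) η :=
    (hmF Λ).mul (freeF_measurable lam' Γ hm2)
  have u1 := freeF_union lam' hdis hm3 ω
  have u2 := freeF_union lam' hdis ((hmF Λ).mul hh) ω
  rw [hΛ] at u1 u2
  refine u1.trans (Eq.trans ?_ u2.symm)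
  refine freeF_congr lam' fun η hη => ?_
  have hη' : Ag Λ η ω := hη.mono Finset.sdiff_subset
  obtain ⟨a, ha⟩ := hfac η
  have l1 : freeF lam' Γ (fun η =>
      (ρF Λ η : ℝ≥0∞) * freeF lam' Γ (fun ζ => (ρF Γ ζ : ℝ≥0∞) * h ζ) η) η =
      (a * freeF lam' Γ (fun ζ => (ρF Γ ζ : ℝ≥0∞) * h ζ) η) *
        freeF lam' Γ (fun ζ => (ρF Γ ζ : ℝ≥0∞)) η := by
    rw [← freeF_const_mul _ _ (hmF Γ)]
    refine freeF_congr lam' fun ζ hζ => ?_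
    rw [freeF_ag lam' _ hζ, ha ζ hζ]
    ring
  have l2 : freeF lam' Γ ((fun η => (ρF Λ η : ℝ≥0∞)) * h) η =
      a * freeF lam' Γ (fun ζ => (ρF Γ ζ : ℝ≥0∞) * h ζ) η := by
    rw [← freeF_const_mul _ _ hm2]
    refine freeF_congr lam' fun ζ hζ => ?_
    rw [Pi.mul_apply, ha ζ hζ]
    ring
  refine l1.trans (Eq.trans ?_ l2.symm)
  by_cases ha0 : a = 0
  · simp [ha0]
  · have := hres η hη' a ha0 ha (fun _ => 1)
    simp only [mul_one] at this
    rw [this, normalized hmeas hnorm h1 hrec Γ η, mul_one]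

end GibbsSingleton

open GibbsSingleton MeasureTheory ProbabilityTheory

/-- **(P2).**  For the recursively constructed family, the kernels `ρ_Λ λ_Λ` are
consistent: for every finite `Λ`, every `Γ ⊆ Λ` and every bounded measurable `h`,
`(ρ_Λ λ_Λ)((ρ_Γ λ_Γ)(h)) = (ρ_Λ λ_Λ)(h)`. -/
theorem constructed_family_consistent
    {d : ℕ} (hd : 0 < d) {E : Type*} [MeasurableSpace E]
    (lam : (Fin d → ℤ) → Measure E)
    (ρ : (Fin d → ℤ) → Config (Fin d → ℤ) E → ℝ≥0)
    (hmeas : ∀ i, Measurable (ρ i))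
    (hnorm : ∀ (i : Fin d → ℤ) (ω : Config (Fin d → ℤ) E),
      freeF lam {i} (fun η => (ρ i η : ℝ≥0∞)) ω = 1)
    (h1 : H1 lam ρ) (h2 : H2 lam ρ)
    (ρF : Finset (Fin d → ℤ) → Config (Fin d → ℤ) E → ℝ≥0)
    (hrec : IsRec lam ρ ρF) :
    ∀ (Λ Γ : Finset (Fin d → ℤ)), Γ ⊆ Λ →
      ∀ h : Config (Fin d → ℤ) E → ℝ≥0∞, Measurable h → (∃ C : ℝ≥0, ∀ ω, h ω ≤ C) →
      ∀ ω : Config (Fin d → ℤ) E,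
        freeF lam Λ
          (fun η => (ρF Λ η : ℝ≥0∞) * freeF lam Γ (fun ζ => (ρF Γ ζ : ℝ≥0∞) * h ζ) η) ω
        = freeF lam Λ (fun η => (ρF Λ η : ℝ≥0∞) * h η) ω := by
  intro Λ Γ hΓ h hh _ ω
  exact core hmeas hnorm h1 hrec Λ Γ hΓ h hh ω
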